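/- arXiv:1510.05567 — 9 statements merged into one kernel-verified Lean document; each statement's English description precedes it below -/
import Mathlib

section
/- Under McNaughton's wrap-around schedule, no job ever executes on two processors simultaneously: for every job i ∈ {0, …, n − 1} and every local time τ ∈ [0, 1), there is at most one processor index k ∈ {0, …, m − 1} such that S i ≤ k + τ < S (i + 1). -/
/-- Under McNaughton's wrap-around schedule, no job ever executes on two
processors simultaneously. -/
theorem mcnaughton_no_parallel_execution
    (m n : ℕ) (hm : 1 ≤ m) (a : Fin n → ℝ)
    (ha0 : ∀ i, 0 ≤ a i) (ha1 : ∀ i, a i ≤ 1)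
    (hsum : ∑ i, a i ≤ (m : ℝ))
    (S : ℕ → ℝ) (hS0 : S 0 = 0)
    (hS : ∀ i : Fin n, S ((i : ℕ) + 1) = S i + a i) :
    ∀ i : Fin n, ∀ τ ∈ Set.Ico (0 : ℝ) 1, ∀ k₁ k₂ : Fin m,
      (S i ≤ (k₁ : ℝ) + τ ∧ (k₁ : ℝ) + τ < S ((i : ℕ) + 1)) →
      (S i ≤ (k₂ : ℝ) + τ ∧ (k₂ : ℝ) + τ < S ((i : ℕ) + 1)) →
      k₁ = k₂ := by
  intro i τ _ k₁ k₂ ⟨h₁, h₁'⟩ ⟨h₂, h₂'⟩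
  have hlen := ha1 i
  rw [hS i] at h₁' h₂'
  have h₁₂ : ((k₁ : ℕ) : ℝ) < (k₂ : ℕ) + 1 := by linarith
  have h₂₁ : ((k₂ : ℕ) : ℝ) < (k₁ : ℕ) + 1 := by linarith
  norm_cast at h₁₂ h₂₁
  exact Fin.ext (by omega)
end

section
/- McNaughton's wrap-around schedule delivers to every job exactly its required execution fraction: for every job i ∈ {0, …, n − 1}, the sum over processors k ∈ {0, …, m − 1} of volume {τ ∈ [0, 1) : S i ≤ k + τ < S (i + 1)} equals a i. -/
open MeasureTheory

/-- Cutting `[x, y) ∩ [0, m)` at the integers preserves its total length. -/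
lemma sum_volume_unit_slices (m : ℕ) {x : ℝ} (hx : 0 ≤ x) (y : ℝ) :
    ∑ k ∈ Finset.range m,
      volume {τ : ℝ | τ ∈ Set.Ico (0 : ℝ) 1 ∧ x ≤ (k : ℝ) + τ ∧ (k : ℝ) + τ < y}
    = ENNReal.ofReal (min (m : ℝ) y - x) := by
  induction m with
  | zero =>
    rw [Finset.sum_range_zero, ENNReal.ofReal_of_nonpos]
    have := min_le_left ((0 : ℕ) : ℝ) y
    push_cast at this ⊢
    linarith
  | succ m ih =>
    have hslice : {τ : ℝ | τ ∈ Set.Ico (0 : ℝ) 1 ∧ x ≤ (m : ℝ) + τ ∧ (m : ℝ) + τ < y}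
        = Set.Ico (max 0 (x - m)) (min 1 (y - m)) := by
      ext τ
      simp only [Set.mem_ofPred_eq, Set.mem_Ico, max_le_iff, lt_min_iff, sub_le_iff_le_add',
        lt_sub_iff_add_lt']
      tauto
    rw [Finset.sum_range_succ, ih, hslice, Real.volume_Ico]
    push_cast
    rcases le_total x m with hxm | hxm
    · rw [max_eq_left (sub_nonpos.mpr hxm), sub_zero]
      rcases le_total y m with hym | hym
      · rw [min_eq_right hym, min_eq_right (by linarith : y ≤ (m : ℝ) + 1),
          min_eq_right (by linarith : y - m ≤ 1), ENNReal.ofReal_of_nonpos (sub_nonpos.mpr hym),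
          add_zero]
      · rw [min_eq_left hym, ← ENNReal.ofReal_add (sub_nonneg.mpr hxm)
          (le_min zero_le_one (sub_nonneg.mpr hym)), ← add_sub_cancel_left (m : ℝ) 1,
          min_sub_sub_right]
        congr 1
        ring_nf
    · rw [max_eq_right (sub_nonneg.mpr hxm),
        ENNReal.ofReal_of_nonpos (sub_nonpos.mpr ((min_le_left _ _).trans hxm)), zero_add,
        ← add_sub_cancel_left (m : ℝ) 1, min_sub_sub_right, sub_sub_sub_cancel_right,
        add_sub_cancel_left]

/-- McNaughton's wrap-around schedule delivers to every job exactly its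
required execution fraction. -/
theorem mcnaughton_workload_met
    (m n : ℕ) (hm : 1 ≤ m) (a : Fin n → ℝ)
    (ha0 : ∀ i, 0 ≤ a i) (ha1 : ∀ i, a i ≤ 1)
    (hsum : ∑ i, a i ≤ (m : ℝ))
    (S : ℕ → ℝ) (hS0 : S 0 = 0)
    (hS : ∀ i : Fin n, S ((i : ℕ) + 1) = S i + a i) :
    ∀ i : Fin n,
      ∑ k : Fin m,
        volume {τ : ℝ | τ ∈ Set.Ico (0 : ℝ) 1 ∧
          S i ≤ (k : ℝ) + τ ∧ (k : ℝ) + τ < S ((i : ℕ) + 1)}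
      = ENNReal.ofReal (a i) := by
  have hmono : ∀ j k, j ≤ k → k ≤ n → S j ≤ S k := by
    intro j k hjk
    induction k, hjk using Nat.le_induction with
    | base => exact fun _ => le_rfl
    | succ k _ ih =>
      intro hk
      have hstep : S (k + 1) = S k + a ⟨k, hk⟩ := hS ⟨k, hk⟩
      linarith [ih (by omega), ha0 ⟨k, hk⟩]
  have htotal : ∑ i, a i = S n := by
    calc ∑ i, a i = ∑ i : Fin n, (S ((i : ℕ) + 1) - S i) :=
          Finset.sum_congr rfl fun i _ => by rw [hS i, add_sub_cancel_left]
      _ = S n := by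
          rw [Fin.sum_univ_eq_sum_range (fun j => S (j + 1) - S j), Finset.sum_range_sub, hS0,
            sub_zero]
  intro i
  have hnonneg : 0 ≤ S i := hS0 ▸ hmono 0 i (Nat.zero_le _) i.isLt.le
  have hle : S ((i : ℕ) + 1) ≤ m :=
    (hmono _ n i.isLt le_rfl).trans (htotal ▸ hsum)
  rw [Fin.sum_univ_eq_sum_range (fun k : ℕ =>
      volume {τ : ℝ | τ ∈ Set.Ico (0 : ℝ) 1 ∧ S i ≤ (k : ℝ) + τ ∧ (k : ℝ) + τ < S ((i : ℕ) + 1)}),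
    sum_volume_unit_slices m hnonneg, min_eq_right hle, hS i, add_sub_cancel_left]
end

section
/- Under McNaughton's wrap-around schedule, every job executes on at most two distinct processors: for every job i ∈ {0, …, n − 1}, the cardinality of the set {k ∈ {0, …, m − 1} : ∃ τ ∈ [0, 1), S i ≤ k + τ < S (i + 1)} is at most 2. -/
/-- At most two elements of `Fin m` have a unit cell `[k, k + 1)` that meets a given half-open
interval of length at most one. -/
theorem ncard_unit_cells_meeting_le_two (m : ℕ) {x y : ℝ} (hxy : y ≤ x + 1) :
    Set.ncard {k : Fin m | ∃ τ ∈ Set.Ico (0 : ℝ) 1,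
      x ≤ (k : ℝ) + τ ∧ (k : ℝ) + τ < y} ≤ 2 := by
  have hinj : Function.Injective fun k : Fin m => ((k : ℕ) : ℤ) :=
    Nat.cast_injective.comp Fin.val_injective
  rw [← Set.ncard_image_of_injective _ hinj]
  refine (Set.ncard_le_ncard (t := {⌊x⌋, ⌊x⌋ + 1}) ?_ (Set.toFinite _)).trans
    (Set.ncard_pair (by omega)).le
  rintro _ ⟨k, ⟨τ, ⟨hτ0, hτ1⟩, hx, hy⟩, rfl⟩
  have hlow : ⌊x⌋ < ((k : ℕ) : ℤ) + 1 := by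
    rw [Int.floor_lt]
    push_cast
    linarith
  have hhigh : ((k : ℕ) : ℤ) - 1 ≤ ⌊x⌋ := by
    rw [Int.le_floor]
    push_cast
    linarith
  simp only [Set.mem_insert_iff, Set.mem_singleton_iff]
  omega

/-- Under McNaughton's wrap-around schedule, every job executes on at most
two distinct processors. -/
theorem mcnaughton_at_most_two_processors
    (m n : ℕ) (hm : 1 ≤ m) (a : Fin n → ℝ)
    (ha0 : ∀ i, 0 ≤ a i) (ha1 : ∀ i, a i ≤ 1)
    (hsum : ∑ i, a i ≤ (m : ℝ))
    (S : ℕ → ℝ) (hS0 : S 0 = 0)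
    (hS : ∀ i : Fin n, S ((i : ℕ) + 1) = S i + a i) :
    ∀ i : Fin n,
      Set.ncard {k : Fin m | ∃ τ ∈ Set.Ico (0 : ℝ) 1,
        S i ≤ (k : ℝ) + τ ∧ (k : ℝ) + τ < S ((i : ℕ) + 1)} ≤ 2 := by
  intro i
  exact ncard_unit_cells_meeting_le_two m (by linarith [hS i, ha1 i])
end

section
/- McNaughton's wrap-around schedule incurs at most m − 1 task migrations per slice: the number of jobs i ∈ {0, …, n − 1} for which there exist two distinct processor indices k₁ ≠ k₂ in {0, …, m − 1} and local times τ₁, τ₂ ∈ [0, 1) with S i ≤ k₁ + τ₁ < S (i + 1) and S i ≤ k₂ + τ₂ < S (i + 1) is at most m − 1. -/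
/-- A sequence whose first `n` steps are nonnegative is monotone up to index `n`. -/
theorem le_of_nonneg_steps {n : ℕ} {a : Fin n → ℝ} (ha : ∀ i, 0 ≤ a i) {S : ℕ → ℝ}
    (hS : ∀ i : Fin n, S ((i : ℕ) + 1) = S i + a i) {p q : ℕ} (hpq : p ≤ q) (hq : q ≤ n) :
    S p ≤ S q := by
  induction q, hpq using Nat.le_induction with
  | base => exact le_rfl
  | succ q _ ih =>
    have hstep := hS ⟨q, hq⟩
    have hnonneg := ha ⟨q, hq⟩
    have := ih (by omega)
    dsimp only at hstep
    linarith

/-- A half-open interval that meets two distinct unit cells `[k₁, k₁ + 1)` and `[k₂, k₂ + 1)`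
contains a positive integer in its interior, namely the larger of `k₁` and `k₂`. -/
theorem exists_nat_between_of_meets_two_cells {m : ℕ} {x y : ℝ} {k₁ k₂ : Fin m} (hne : k₁ ≠ k₂)
    (h₁ : ∃ τ ∈ Set.Ico (0 : ℝ) 1, x ≤ (k₁ : ℝ) + τ ∧ (k₁ : ℝ) + τ < y)
    (h₂ : ∃ τ ∈ Set.Ico (0 : ℝ) 1, x ≤ (k₂ : ℝ) + τ ∧ (k₂ : ℝ) + τ < y) :
    ∃ k ∈ Set.Ico 1 m, x < (k : ℝ) ∧ (k : ℝ) < y := by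
  wlog hlt : k₁ < k₂ generalizing k₁ k₂
  · exact this hne.symm h₂ h₁ (lt_of_le_of_ne (not_lt.mp hlt) hne.symm)
  obtain ⟨τ₁, ⟨_, hτ₁⟩, hx, _⟩ := h₁
  obtain ⟨τ₂, ⟨hτ₂, _⟩, _, hy⟩ := h₂
  have hlt' : (k₁ : ℕ) + 1 ≤ k₂ := hlt
  have hcast : ((k₁ : ℕ) : ℝ) + 1 ≤ (k₂ : ℕ) := by exact_mod_cast hlt'
  exact ⟨k₂, ⟨by omega, k₂.isLt⟩, by linarith, by linarith⟩

/-- McNaughton's wrap-around schedule incurs at most `m - 1` task migrations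
per slice. -/
theorem mcnaughton_migrations_le
    (m n : ℕ) (hm : 1 ≤ m) (a : Fin n → ℝ)
    (ha0 : ∀ i, 0 ≤ a i) (ha1 : ∀ i, a i ≤ 1)
    (hsum : ∑ i, a i ≤ (m : ℝ))
    (S : ℕ → ℝ) (hS0 : S 0 = 0)
    (hS : ∀ i : Fin n, S ((i : ℕ) + 1) = S i + a i) :
    Set.ncard {i : Fin n | ∃ k₁ k₂ : Fin m, k₁ ≠ k₂ ∧
      (∃ τ₁ ∈ Set.Ico (0 : ℝ) 1,
        S i ≤ (k₁ : ℝ) + τ₁ ∧ (k₁ : ℝ) + τ₁ < S ((i : ℕ) + 1)) ∧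
      (∃ τ₂ ∈ Set.Ico (0 : ℝ) 1,
        S i ≤ (k₂ : ℝ) + τ₂ ∧ (k₂ : ℝ) + τ₂ < S ((i : ℕ) + 1))} ≤ m - 1 := by
  have hk (i : Fin n) (hi : i ∈ {i : Fin n | ∃ k₁ k₂ : Fin m, k₁ ≠ k₂ ∧
      (∃ τ₁ ∈ Set.Ico (0 : ℝ) 1,
        S i ≤ (k₁ : ℝ) + τ₁ ∧ (k₁ : ℝ) + τ₁ < S ((i : ℕ) + 1)) ∧
      (∃ τ₂ ∈ Set.Ico (0 : ℝ) 1,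
        S i ≤ (k₂ : ℝ) + τ₂ ∧ (k₂ : ℝ) + τ₂ < S ((i : ℕ) + 1))}) :
      ∃ k ∈ Set.Ico 1 m, S i < (k : ℝ) ∧ (k : ℝ) < S ((i : ℕ) + 1) := by
    obtain ⟨k₁, k₂, hne, h₁, h₂⟩ := hi
    exact exists_nat_between_of_meets_two_cells hne h₁ h₂
  choose! f hf hlo hhi using hk
  have hcard : (Set.Ico 1 m).ncard = m - 1 := by
    rw [← Finset.coe_Ico, Set.ncard_coe_finset, Nat.card_Ico]
  refine hcard ▸ Set.ncard_le_ncard_of_injOn f hf ?_ (Set.finite_Ico 1 m)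
  have not_lt_of_eq {i j : Fin n} (hi : (f i : ℝ) < S ((i : ℕ) + 1)) (hj : S j < (f j : ℝ))
      (hij : f i = f j) : ¬ i < j := fun hlt => by
    have := le_of_nonneg_steps ha0 hS (Nat.succ_le_of_lt hlt) j.isLt.le
    rw [hij] at hi
    exact absurd (hi.trans_le this) hj.not_gt
  intro i hi j hj hij
  exact le_antisymm (not_lt.mp (not_lt_of_eq (hhi j hj) (hlo i hi) hij.symm))
    (not_lt.mp (not_lt_of_eq (hhi i hi) (hlo j hj) hij))
end

section
/- Schedule existence via McNaughton's wrap-around algorithm (the key step in the proof of Theorem 2): let a : Fin n → ℝ satisfy 0 ≤ a i ≤ 1 for every i and ∑ i, a i ≤ m. Then there exists a valid schedule of the n jobs on m processors over [0, h) meeting the workloads w i = a i · h; moreover each set σ i k can be chosen to be an interval. -/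
open MeasureTheory

/-- Clamping `x - k * h` to `[0, h]` and summing over `k < m` recovers `min x (m * h)`. -/
lemma sum_range_clamp_sub_mul {h x : ℝ} (hh : 0 ≤ h) (hx : 0 ≤ x) (m : ℕ) :
    ∑ k ∈ Finset.range m, min h (max 0 (x - k * h)) = min x (m * h) := by
  induction m with
  | zero => simp [hx]
  | succ m ih =>
    rw [Finset.sum_range_succ, ih]
    push_cast
    rw [add_mul, one_mul]
    rcases le_total x (m * h) with h1 | h1
    · rw [min_eq_left h1, max_eq_left (by linarith), min_eq_right hh,
        min_eq_left (by linarith), add_zero]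
    · rw [min_eq_right h1, max_eq_right (by linarith), ← min_add_add_left]
      rw [add_sub_cancel, min_comm]

lemma volume_Ico_max_min_toReal {h s e : ℝ} (hh : 0 ≤ h) (hse : s ≤ e) :
    (volume (Set.Ico (max 0 s) (min h e))).toReal =
      min h (max 0 e) - min h (max 0 s) := by
  rw [Real.volume_Ico, ENNReal.toReal_ofReal']
  grind

/-- Cutting `[s, e) ⊆ [0, m * h)` at the multiples of `h` preserves the total length. -/
lemma sum_volume_Ico_wrap {h s e : ℝ} {m : ℕ} (hh : 0 ≤ h) (hs : 0 ≤ s) (hse : s ≤ e)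
    (he : e ≤ m * h) :
    ∑ k : Fin m, (volume (Set.Ico (max 0 (s - k * h)) (min h (e - k * h)))).toReal = e - s := by
  have key (k : Fin m) := volume_Ico_max_min_toReal hh (sub_le_sub_right hse ((k : ℝ) * h))
  simp only [key]
  rw [Fin.sum_univ_eq_sum_range
    (fun k : ℕ => min h (max 0 (e - k * h)) - min h (max 0 (s - k * h))) m,
    Finset.sum_sub_distrib, sum_range_clamp_sub_mul hh (hs.trans hse),
    sum_range_clamp_sub_mul hh hs, min_eq_left he, min_eq_left (hse.trans he)]

lemma sum_Iio_add_le_sum {n : ℕ} {w : Fin n → ℝ} (hw : ∀ i, 0 ≤ w i) {i : Fin n}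
    {s : Finset (Fin n)} (hs : Finset.Iic i ⊆ s) :
    ∑ j ∈ Finset.Iio i, w j + w i ≤ ∑ j ∈ s, w j := by
  rw [add_comm, ← Finset.sum_insert (by simp), Finset.Iio_insert]
  exact Finset.sum_le_sum_of_subset_of_nonneg hs fun j _ _ => hw j

/-- Schedule existence via McNaughton's wrap-around algorithm: execution
fractions `a` with `0 ≤ a i ≤ 1` and `∑ i, a i ≤ m` admit a valid schedule
over `[0, h)` meeting workloads `a i * h`, with each execution set an
interval (an order-convex subset of `ℝ`). -/
theorem mcnaughton_schedule_exists
    (m n : ℕ) (hm : 1 ≤ m) (h : ℝ) (hh : 0 < h)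
    (a : Fin n → ℝ) (ha0 : ∀ i, 0 ≤ a i) (ha1 : ∀ i, a i ≤ 1)
    (hsum : ∑ i, a i ≤ (m : ℝ)) :
    ∃ σ : Fin n → Fin m → Set ℝ,
      (∀ i k, MeasurableSet (σ i k)) ∧
      (∀ i k, σ i k ⊆ Set.Ico (0 : ℝ) h) ∧
      (∀ i k, (σ i k).OrdConnected) ∧
      (∀ t ∈ Set.Ico (0 : ℝ) h, ∀ k : Fin m, ∀ i₁ i₂ : Fin n,
        t ∈ σ i₁ k → t ∈ σ i₂ k → i₁ = i₂) ∧
      (∀ t ∈ Set.Ico (0 : ℝ) h, ∀ i : Fin n, ∀ k₁ k₂ : Fin m,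
        t ∈ σ i k₁ → t ∈ σ i k₂ → k₁ = k₂) ∧
      (∀ i, ∑ k : Fin m, (volume (σ i k)).toReal = a i * h) := by
  have hw : ∀ i, 0 ≤ a i * h := fun i => mul_nonneg (ha0 i) hh.le
  have hstart : ∀ i : Fin n, 0 ≤ ∑ j ∈ Finset.Iio i, a j * h :=
    fun i => Finset.sum_nonneg fun j _ => hw j
  have hend (i : Fin n) : ∑ j ∈ Finset.Iio i, a j * h + a i * h ≤ m * h := by
    refine (sum_Iio_add_le_sum hw (Finset.subset_univ _)).trans ?_
    rw [← Finset.sum_mul]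
    exact mul_le_mul_of_nonneg_right hsum hh.le
  have hstep (i j : Fin n) (hij : i < j) :
      ∑ l ∈ Finset.Iio i, a l * h + a i * h ≤ ∑ l ∈ Finset.Iio j, a l * h :=
    sum_Iio_add_le_sum hw fun l hl => by
      simp only [Finset.mem_Iic, Finset.mem_Iio] at hl ⊢
      exact hl.trans_lt hij
  generalize hS : (fun i : Fin n => ∑ j ∈ Finset.Iio i, a j * h) = S
  replace hS (i : Fin n) : ∑ j ∈ Finset.Iio i, a j * h = S i := congrFun hS i
  simp only [hS] at hstart hend hstep
  refine ⟨fun i k => Set.Ico (max 0 (S i - k * h)) (min h (S i + a i * h - k * h)),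
    fun _ _ => measurableSet_Ico,
    fun _ _ => Set.Ico_subset_Ico (le_max_left _ _) (min_le_left _ _),
    fun _ _ => Set.ordConnected_Ico, ?_, ?_, fun i => ?_⟩
  · intro t _ k i₁ i₂ h₁ h₂
    simp only [Set.mem_Ico, max_le_iff, lt_min_iff] at h₁ h₂
    rcases lt_trichotomy i₁ i₂ with hlt | heq | hlt
    · linarith [hstep _ _ hlt]
    · exact heq
    · linarith [hstep _ _ hlt]
  · intro t _ i k₁ k₂ h₁ h₂
    simp only [Set.mem_Ico, max_le_iff, lt_min_iff] at h₁ h₂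
    have hle : a i * h ≤ h := mul_le_of_le_one_left hh.le (ha1 i)
    have hgap (k l : Fin m) (hkl : k < l) : (k : ℝ) * h + h ≤ l * h := by
      have hcast : (k : ℝ) + 1 ≤ l := by exact_mod_cast hkl
      linarith [mul_le_mul_of_nonneg_right hcast hh.le]
    rcases lt_trichotomy k₁ k₂ with hlt | heq | hlt
    · linarith [hgap _ _ hlt]
    · exact heq
    · linarith [hgap _ _ hlt]
  · rw [sum_volume_Ico_wrap hh.le (hstart i) (le_add_of_nonneg_right (hw i)) (hend i)]
    ring
end

section
/- Feasibility characterization (feasibility optimality of the fluid/wrap-around scheme): workloads w : Fin n → ℝ with 0 ≤ w i for all i admit a valid schedule of the n jobs on m processors over [0, h) meeting them if and only if w i ≤ h for every job i and ∑ i, w i ≤ m · h. -/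
open MeasureTheory

/-- Pairwise disjoint measurable subsets of `[0, h)` have total length at most `h`. -/
theorem sum_volume_toReal_le_of_subset_Ico {ι : Type*} [Fintype ι] {h : ℝ} (hh : 0 ≤ h)
    {s : ι → Set ℝ} (hs : ∀ i, MeasurableSet (s i)) (hsub : ∀ i, s i ⊆ Set.Ico 0 h)
    (hdisj : ∀ t ∈ Set.Ico 0 h, ∀ i j, t ∈ s i → t ∈ s j → i = j) :
    ∑ i, (volume (s i)).toReal ≤ h := by
  have hfin : ∀ i, volume (s i) ≠ ⊤ := fun i =>
    measure_ne_top_of_subset (hsub i) measure_Ico_lt_top.ne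
  have hpair : Pairwise (Function.onFun Disjoint s) := fun i j hij =>
    Set.disjoint_left.2 fun t hi hj => hij (hdisj t (hsub i hi) i j hi hj)
  rw [← ENNReal.toReal_sum fun i _ => hfin i, ← tsum_fintype (L := .unconditional ι),
    ← measure_iUnion hpair hs]
  refine (ENNReal.toReal_mono measure_Ico_lt_top.ne
    (measure_mono (Set.iUnion_subset hsub))).trans ?_
  simp [hh]

/-- Cutting `[a, b) ⊆ [0, m * h)` at the multiples of `h` and translating the pieces
to `[0, h)` preserves the total length. -/
theorem sum_volume_toReal_wrap {m : ℕ} {a b h : ℝ} (hh : 0 ≤ h) (ha : 0 ≤ a) (hab : a ≤ b)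
    (hb : b ≤ m * h) :
    ∑ k : Fin m, (volume (Set.Ico 0 h ∩ (fun t => t + (k : ℝ) * h) ⁻¹' Set.Ico a b)).toReal
      = b - a := by
  set F : ℕ → ℝ := fun k => volume.real (Set.Ico a b ∩ Set.Iio (k * h)) with hF
  have hpiece (k : ℕ) :
      (volume (Set.Ico 0 h ∩ (fun t => t + (k : ℝ) * h) ⁻¹' Set.Ico a b)).toReal
        = F (k + 1) - F k := by
    have hset : Set.Ico 0 h ∩ (fun t => t + (k : ℝ) * h) ⁻¹' Set.Ico a b =
        (fun t => t + (k : ℝ) * h) ⁻¹' ((Set.Ico a b ∩ Set.Iio (((k + 1 : ℕ) : ℝ) * h)) \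
          (Set.Ico a b ∩ Set.Iio (k * h))) := by
      ext t
      simp only [Set.mem_inter_iff, Set.mem_preimage, Set.mem_Ico, Set.mem_Iio, Set.mem_sdiff]
      push_cast
      constructor
      · rintro ⟨⟨h0, h1⟩, h2⟩
        exact ⟨⟨h2, by linarith⟩, fun h3 => by linarith [h3.2]⟩
      · rintro ⟨⟨h2, h3⟩, h4⟩
        have h5 : (k : ℝ) * h ≤ t + k * h := not_lt.1 fun h5 => h4 ⟨h2, h5⟩
        exact ⟨⟨by linarith, by linarith⟩, h2⟩
    rw [hset, measure_preimage_add_right]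
    refine measureReal_sdiff (Set.inter_subset_inter_right _ (Set.Iio_subset_Iio ?_))
      (measurableSet_Ico.inter measurableSet_Iio)
      (measure_ne_top_of_subset Set.inter_subset_left measure_Ico_lt_top.ne)
    push_cast
    linarith
  have hF0 : F 0 = 0 := by
    have : Set.Ico a b ∩ Set.Iio (((0 : ℕ) : ℝ) * h) = ∅ := by
      ext t
      simp only [Set.mem_inter_iff, Set.mem_Ico, Set.mem_Iio, Nat.cast_zero, zero_mul,
        Set.mem_empty_iff_false, iff_false]
      rintro ⟨⟨h1, -⟩, h2⟩
      linarith
    simp only [hF, this, measureReal_empty]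
  have hFm : F m = b - a := by
    have : Set.Ico a b ∩ Set.Iio ((m : ℝ) * h) = Set.Ico a b :=
      Set.inter_eq_left.2 fun t ht => ht.2.trans_le hb
    simp only [hF, this, Real.volume_real_Ico_of_le hab]
  simp only [hpiece]
  rw [Fin.sum_univ_eq_sum_range (fun k => F (k + 1) - F k), Finset.sum_range_sub, hF0, hFm,
    sub_zero]

/-- Feasibility characterization: nonnegative workloads `w` admit a valid
schedule of `n` jobs on `m` processors over `[0, h)` meeting them iff
`w i ≤ h` for every job and `∑ i, w i ≤ m * h`. -/
theorem schedule_feasibility_iff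
    (m n : ℕ) (hm : 1 ≤ m) (h : ℝ) (hh : 0 < h)
    (w : Fin n → ℝ) (hw0 : ∀ i, 0 ≤ w i) :
    (∃ σ : Fin n → Fin m → Set ℝ,
      (∀ i k, MeasurableSet (σ i k)) ∧
      (∀ i k, σ i k ⊆ Set.Ico (0 : ℝ) h) ∧
      (∀ t ∈ Set.Ico (0 : ℝ) h, ∀ k : Fin m, ∀ i₁ i₂ : Fin n,
        t ∈ σ i₁ k → t ∈ σ i₂ k → i₁ = i₂) ∧
      (∀ t ∈ Set.Ico (0 : ℝ) h, ∀ i : Fin n, ∀ k₁ k₂ : Fin m,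
        t ∈ σ i k₁ → t ∈ σ i k₂ → k₁ = k₂) ∧
      (∀ i, ∑ k : Fin m, (volume (σ i k)).toReal = w i))
    ↔ ((∀ i, w i ≤ h) ∧ ∑ i, w i ≤ (m : ℝ) * h) := by
  constructor
  · rintro ⟨σ, hmeas, hsub, hproc, hjob, hvol⟩
    constructor
    · intro i
      rw [← hvol i]
      exact sum_volume_toReal_le_of_subset_Ico hh.le (hmeas i) (hsub i)
        fun t ht => hjob t ht i
    · simp only [← hvol]
      rw [Finset.sum_comm]
      calc ∑ k, ∑ i, (volume (σ i k)).toReal ≤ ∑ _k : Fin m, h :=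
            Finset.sum_le_sum fun k _ => sum_volume_toReal_le_of_subset_Ico hh.le
              (fun i => hmeas i k) (fun i => hsub i k) fun t ht => hproc t ht k
        _ = m * h := by simp
  · rintro ⟨hwh, hsum⟩
    set S : Fin n → ℝ := fun i => ∑ j ∈ Finset.Iio i, w j with hS
    have hS0 (i : Fin n) : 0 ≤ S i := Finset.sum_nonneg fun j _ => hw0 j
    have hSw (i : Fin n) : S i + w i = ∑ j ∈ Finset.Iic i, w j := by
      rw [← Finset.Iio_insert, Finset.sum_insert (by simp), add_comm]
    have hmono {i j : Fin n} (hij : i < j) : S i + w i ≤ S j := by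
      rw [hSw]
      refine Finset.sum_le_sum_of_subset_of_nonneg (fun x hx => ?_) fun x _ _ => hw0 x
      exact Finset.mem_Iio.2 ((Finset.mem_Iic.1 hx).trans_lt hij)
    have htotal (i : Fin n) : S i + w i ≤ m * h := by
      rw [hSw]
      exact (Finset.sum_le_sum_of_subset_of_nonneg (Finset.subset_univ _)
        fun x _ _ => hw0 x).trans hsum
    refine ⟨fun i k => Set.Ico 0 h ∩
      (fun t => t + (k : ℝ) * h) ⁻¹' Set.Ico (S i) (S i + w i), ?_, ?_, ?_, ?_, ?_⟩
    · exact fun i k => measurableSet_Ico.inter (measurableSet_Ico.preimage (by fun_prop))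
    · exact fun i k => Set.inter_subset_left
    · rintro t - k i j ⟨-, hi⟩ ⟨-, hj⟩
      rcases lt_trichotomy i j with hij | hij | hij
      · exact absurd (hi.2.trans_le (hmono hij)) (not_lt.2 hj.1)
      · exact hij
      · exact absurd (hj.2.trans_le (hmono hij)) (not_lt.2 hi.1)
    · have hle {t : ℝ} {i : Fin n} {k l : Fin m}
          (hk : t + (k : ℝ) * h ∈ Set.Ico (S i) (S i + w i))
          (hl : t + (l : ℝ) * h ∈ Set.Ico (S i) (S i + w i)) : k ≤ l := by
        have hlt : (k : ℝ) * h < (l + 1) * h := by linarith [hk.2, hl.1, hwh i]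
        have hlt' : (k : ℕ) < l + 1 := by exact_mod_cast lt_of_mul_lt_mul_right hlt hh.le
        exact Fin.le_def.2 (Nat.lt_succ_iff.1 hlt')
      rintro t - i k l ⟨-, hk⟩ ⟨-, hl⟩
      exact le_antisymm (hle hk hl) (hle hl hk)
    · intro i
      rw [sum_volume_toReal_wrap hh.le (hS0 i) (le_add_of_nonneg_right (hw0 i)) (htotal i),
        add_sub_cancel_left]
end

section
/- Grouped (discrete-speed) schedule existence, the construction underlying the LP-DVFS formulation: let l ≥ 1 be a number of speed levels and a : Fin n → Fin l → ℝ satisfy 0 ≤ a i q for all i, q, ∑ q, a i q ≤ 1 for every job i, and ∑ i, ∑ q, a i q ≤ m. Then there exist Lebesgue-measurable sets σ : Fin n → Fin l → Fin m → Set ℝ with σ i q k ⊆ [0, h) (the set of times at which job i executes at speed level q on processor k) such that: for every time t ∈ [0, h) and every processor k there is at most one pair (i, q) with t ∈ σ i q k; for every time t ∈ [0, h) and every job i there is at most one pair (q, k) with t ∈ σ i q k (so a job never runs on two processors or at two speed levels simultaneously); and ∑ k, volume (σ i q k) = a i q · h for every i and q. -/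
open MeasureTheory

/-- The sum of `f` over the indices strictly below `i`. -/
def prefixSum {ι : Type*} [Fintype ι] [LinearOrder ι] (f : ι → ℝ) (i : ι) : ℝ :=
  ∑ x with x < i, f x

section PrefixSum

variable {ι : Type*} [Fintype ι] [LinearOrder ι] {f : ι → ℝ}

lemma prefixSum_nonneg (hf : ∀ i, 0 ≤ f i) (i : ι) : 0 ≤ prefixSum f i :=
  Finset.sum_nonneg fun x _ => hf x

lemma prefixSum_add (f : ι → ℝ) (i : ι) : prefixSum f i + f i = ∑ x with x ≤ i, f x := by
  have : (Finset.univ.filter fun x => x ≤ i) =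
      insert i (Finset.univ.filter fun x => x < i) := by
    ext x
    simp [le_iff_eq_or_lt]
  rw [this, Finset.sum_insert (by simp), add_comm, prefixSum]

lemma prefixSum_add_le_sum (hf : ∀ i, 0 ≤ f i) (i : ι) : prefixSum f i + f i ≤ ∑ x, f x := by
  rw [prefixSum_add]
  exact Finset.sum_le_univ_sum_of_nonneg hf

lemma prefixSum_add_le_prefixSum (hf : ∀ i, 0 ≤ f i) {i j : ι} (hij : i < j) :
    prefixSum f i + f i ≤ prefixSum f j := by
  rw [prefixSum_add]
  refine Finset.sum_le_sum_of_subset_of_nonneg (fun x hx => ?_) fun x _ _ => hf x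
  simp only [Finset.mem_filter, Finset.mem_univ, true_and] at hx ⊢
  exact hx.trans_lt hij

/-- Consecutive half-open intervals of lengths `f i` are pairwise disjoint. -/
lemma eq_of_mem_Ico_prefixSum (hf : ∀ i, 0 ≤ f i) {i j : ι} {y : ℝ}
    (hi : y ∈ Set.Ico (prefixSum f i) (prefixSum f i + f i))
    (hj : y ∈ Set.Ico (prefixSum f j) (prefixSum f j + f j)) : i = j := by
  rcases lt_trichotomy i j with hij | hij | hij
  · linarith [prefixSum_add_le_prefixSum hf hij, hi.2, hj.1]
  · exact hij
  · linarith [prefixSum_add_le_prefixSum hf hij, hj.2, hi.1]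

end PrefixSum

/-- Multiples of `h` whose translates of `t` lie in a half-open interval of length at most `h`
coincide. -/
lemma eq_of_add_mul_mem_Ico {h t u v : ℝ} (hh : 0 < h) (huv : v - u ≤ h) {j k : ℕ}
    (hj : t + j * h ∈ Set.Ico u v) (hk : t + k * h ∈ Set.Ico u v) : j = k := by
  have key : ∀ {j k : ℕ}, t + j * h ∈ Set.Ico u v → t + k * h ∈ Set.Ico u v → j ≤ k := by
    intro j k hj hk
    have hlt : (j : ℝ) * h < ((k : ℝ) + 1) * h := by linarith [hj.2, hk.1]
    have := lt_of_mul_lt_mul_right hlt hh.le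
    exact Nat.lt_succ_iff.mp (by exact_mod_cast this)
  exact le_antisymm (key hj hk) (key hk hj)

/-- Cutting `[u, v) ⊆ [0, m h)` into blocks of length `h` and moving each block to `[0, h)`
preserves total length. -/
lemma sum_volume_wrap {m : ℕ} {h u v : ℝ} (hh : 0 < h) (hu : 0 ≤ u) (huv : u ≤ v)
    (hv : v ≤ m * h) :
    ∑ k : Fin m, (volume (Set.Ico 0 h ∩ (fun t : ℝ => t + (k : ℕ) * h) ⁻¹' Set.Ico u v)).toReal =
      v - u := by
  let B : Fin m → Set ℝ := fun k => Set.Ico ((k : ℕ) * h) ((k : ℕ) * h + h) ∩ Set.Ico u v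
  have hB : ∀ k : Fin m,
      volume (Set.Ico 0 h ∩ (fun t : ℝ => t + (k : ℕ) * h) ⁻¹' Set.Ico u v) = volume (B k) := by
    intro k
    rw [← measure_preimage_add_right volume ((k : ℕ) * h) (B k)]
    congr 1
    ext t
    simp [B, add_comm]
  have hdisj : Pairwise (Function.onFun Disjoint B) := by
    intro j k hjk
    refine Set.disjoint_left.mpr fun y hyj hyk => hjk (Fin.ext ?_)
    have key : ∀ i : Fin m, y ∈ B i → ⌊y / h⌋₊ = i := fun i hi => by
      rw [Nat.floor_eq_iff (div_nonneg (hu.trans hi.2.1) hh.le), le_div_iff₀ hh, div_lt_iff₀ hh]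
      exact ⟨hi.1.1, by linarith [hi.1.2]⟩
    exact (key j hyj).symm.trans (key k hyk)
  have hunion : ⋃ k, B k = Set.Ico u v := by
    refine Set.Subset.antisymm (Set.iUnion_subset fun k => Set.inter_subset_right) fun y hy => ?_
    have hy0 : 0 ≤ y / h := div_nonneg (hu.trans hy.1) hh.le
    have hlt : ⌊y / h⌋₊ < m := by
      rw [Nat.floor_lt hy0, div_lt_iff₀ hh]
      exact hy.2.trans_le hv
    refine Set.mem_iUnion.mpr ⟨⟨_, hlt⟩, ⟨?_, ?_⟩, hy⟩
    · exact (le_div_iff₀ hh).mp (Nat.floor_le hy0)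
    · have := (div_lt_iff₀ hh).mp (Nat.lt_floor_add_one (y / h))
      linarith
  calc _ = ∑ k, (volume (B k)).toReal := Finset.sum_congr rfl fun k _ => by rw [hB]
    _ = (∑ k, volume (B k)).toReal := by
        refine (ENNReal.toReal_sum fun k _ => ?_).symm
        exact measure_ne_top_of_subset Set.inter_subset_right measure_Ico_lt_top.ne
    _ = (volume (Set.Ico u v)).toReal := by
        rw [← hunion, measure_iUnion hdisj fun k => measurableSet_Ico.inter measurableSet_Ico,
          tsum_fintype]
    _ = v - u := by rw [Real.volume_Ico, ENNReal.toReal_ofReal (sub_nonneg.mpr huv)]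

/-- Grouped (discrete-speed) schedule existence underlying the LP-DVFS
formulation: fractions `a i q` of the window `[0, h)` during which job `i`
executes at speed level `q` can be realized by a schedule in which no
processor runs two (job, speed) pairs at once and no job runs on two
processors or at two speed levels at once. -/
theorem lp_dvfs_schedule_exists
    (m n l : ℕ) (hm : 1 ≤ m) (hl : 1 ≤ l) (h : ℝ) (hh : 0 < h)
    (a : Fin n → Fin l → ℝ)
    (ha0 : ∀ i q, 0 ≤ a i q)
    (ha1 : ∀ i, ∑ q, a i q ≤ 1)
    (hsum : ∑ i, ∑ q, a i q ≤ (m : ℝ)) :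
    ∃ σ : Fin n → Fin l → Fin m → Set ℝ,
      (∀ i q k, MeasurableSet (σ i q k)) ∧
      (∀ i q k, σ i q k ⊆ Set.Ico (0 : ℝ) h) ∧
      (∀ t ∈ Set.Ico (0 : ℝ) h, ∀ k : Fin m,
        ∀ i₁ i₂ : Fin n, ∀ q₁ q₂ : Fin l,
          t ∈ σ i₁ q₁ k → t ∈ σ i₂ q₂ k → (i₁, q₁) = (i₂, q₂)) ∧
      (∀ t ∈ Set.Ico (0 : ℝ) h, ∀ i : Fin n,
        ∀ q₁ q₂ : Fin l, ∀ k₁ k₂ : Fin m,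
          t ∈ σ i q₁ k₁ → t ∈ σ i q₂ k₂ → (q₁, k₁) = (q₂, k₂)) ∧
      (∀ i q, ∑ k : Fin m, (volume (σ i q k)).toReal = a i q * h) := by
  let b : Fin n → Fin l → ℝ := fun i q => a i q * h
  let r : Fin n → ℝ := fun i => ∑ q, b i q
  let s : Fin n → Fin l → ℝ := fun i q => prefixSum r i + prefixSum (b i) q
  have hb : ∀ i q, 0 ≤ b i q := fun i q => mul_nonneg (ha0 i q) hh.le
  have hr : ∀ i, 0 ≤ r i := fun i => Finset.sum_nonneg fun q _ => hb i q
  have hrh : ∀ i, r i ≤ h := fun i => by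
    simp only [r, b, ← Finset.sum_mul]
    exact mul_le_of_le_one_left hh.le (ha1 i)
  have htotal : ∑ i, r i ≤ m * h := by
    simp only [r, b, ← Finset.sum_mul]
    exact mul_le_mul_of_nonneg_right hsum hh.le
  have hjob : ∀ i q, Set.Ico (s i q) (s i q + b i q) ⊆
      Set.Ico (prefixSum r i) (prefixSum r i + r i) := fun i q => by
    have h₁ := prefixSum_nonneg (hb i) q
    have h₂ : prefixSum (b i) q + b i q ≤ r i := prefixSum_add_le_sum (hb i) q
    refine Set.Ico_subset_Ico ?_ ?_ <;> simp only [s] <;> linarith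
  have hlevel : ∀ {i q₁ q₂ y}, y ∈ Set.Ico (s i q₁) (s i q₁ + b i q₁) →
      y ∈ Set.Ico (s i q₂) (s i q₂ + b i q₂) → q₁ = q₂ := fun {i q₁ q₂ y} h₁ h₂ => by
    simp only [s, Set.mem_Ico] at h₁ h₂
    refine eq_of_mem_Ico_prefixSum (hb i) (y := y - prefixSum r i) ?_ ?_ <;>
      constructor <;> linarith [h₁.1, h₁.2, h₂.1, h₂.2]
  refine ⟨fun i q k => Set.Ico 0 h ∩
      (fun t : ℝ => t + (k : ℕ) * h) ⁻¹' Set.Ico (s i q) (s i q + b i q), ?_, ?_, ?_, ?_, ?_⟩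
  · exact fun i q k => measurableSet_Ico.inter (measurableSet_Ico.preimage (by fun_prop))
  · exact fun i q k => Set.inter_subset_left
  · rintro t - k i₁ i₂ q₁ q₂ ⟨-, h₁⟩ ⟨-, h₂⟩
    obtain rfl : i₁ = i₂ := eq_of_mem_Ico_prefixSum hr (hjob _ _ h₁) (hjob _ _ h₂)
    rw [hlevel h₁ h₂]
  · rintro t - i q₁ q₂ k₁ k₂ ⟨-, h₁⟩ ⟨-, h₂⟩
    obtain rfl : k₁ = k₂ := Fin.ext <|
      eq_of_add_mul_mem_Ico hh (by linarith [hrh i]) (hjob _ _ h₁) (hjob _ _ h₂)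
    rw [hlevel h₁ h₂]
  · intro i q
    have h₁ := prefixSum_nonneg (hb i) q
    have h₂ := prefixSum_nonneg hr i
    have h₃ : prefixSum (b i) q + b i q ≤ r i := prefixSum_add_le_sum (hb i) q
    have h₄ := prefixSum_add_le_sum hr i
    rw [sum_volume_wrap hh (add_nonneg h₂ h₁) (le_add_of_nonneg_right (hb i q))
      (by linarith), add_sub_cancel_left]
end

section
/- Discrete-time realization with binary assignments (the finite-dimensional core of Theorem 1): let m ≥ 1, let a : Fin n → ℝ satisfy 0 ≤ a i ≤ 1 for every i and ∑ i, a i ≤ m, and let M ≥ n + 1. Then there exist step lengths hstep : Fin M → ℝ with hstep ν ≥ 0 for all ν and ∑ ν, hstep ν = 1, and binary assignments b : Fin n → Fin m → Fin M → ℝ with b i k ν ∈ {0, 1}, such that: for every job i and slot ν, ∑ k, b i k ν ≤ 1 (a job occupies at most one processor in each slot); for every processor k and slot ν, ∑ i, b i k ν ≤ 1 (a processor executes at most one job in each slot); and for every job i, ∑ ν, ∑ k, hstep ν · b i k ν = a i (each job receives exactly its required execution fraction). -/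
/-- The 0/1 vectors with at most `m` ones. -/
def binaryVectors (n m : ℕ) : Set (Fin n → ℝ) :=
  {v | (∀ i, v i = 0 ∨ v i = 1) ∧ ∑ i, v i ≤ (m : ℝ)}

/-- A 0/1-valued family has a natural number as its sum. -/
lemma exists_natCast_eq_sum_of_binary {ι : Type*} (s : Finset ι) (v : ι → ℝ)
    (hv : ∀ i ∈ s, v i = 0 ∨ v i = 1) : ∃ N : ℕ, ∑ i ∈ s, v i = N := by
  refine ⟨∑ i ∈ s, if v i = 1 then 1 else 0, ?_⟩
  push_cast
  refine Finset.sum_congr rfl fun i hi => ?_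
  rcases hv i hi with h | h <;> simp [h]

/-- A point `x` between `x + s • d` and `x - t • d` lies in a convex set containing both. -/
lemma Convex.mem_of_add_smul_mem_of_sub_smul_mem {E : Type*} [AddCommGroup E] [Module ℝ E]
    {C : Set E} (hC : Convex ℝ C) {x d : E} {s t : ℝ} (hs : 0 < s) (ht : 0 < t)
    (h₁ : x + s • d ∈ C) (h₂ : x - t • d ∈ C) : x ∈ C := by
  have hst : s + t ≠ 0 := by positivity
  have h := hC h₁ h₂ (a := t / (s + t)) (b := s / (s + t)) (by positivity) (by positivity)
    (by field_simp; ring)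
  have hx : (t / (s + t)) • (x + s • d) + (s / (s + t)) • (x - t • d) = x := by
    match_scalars <;> field_simp <;> ring
  rwa [hx] at h

/-- The unit cube cut by `∑ i, x i ≤ m` is contained in the convex hull of its 0/1 points. -/
lemma mem_convexHull_binaryVectors {n m : ℕ} (x : Fin n → ℝ) (h0 : ∀ i, 0 ≤ x i)
    (h1 : ∀ i, x i ≤ 1) (hsum : ∑ i, x i ≤ (m : ℝ)) :
    x ∈ convexHull ℝ (binaryVectors n m) := by
  classical
  induction hk : (Finset.univ.filter fun i => 0 < x i ∧ x i < 1).card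
    using Nat.strong_induction_on generalizing x with
  | _ k ih =>
  have step : ∀ y : Fin n → ℝ, (∀ i, 0 ≤ y i) → (∀ i, y i ≤ 1) → ∑ i, y i ≤ (m : ℝ) →
      (∀ l, 0 < y l ∧ y l < 1 → 0 < x l ∧ x l < 1) →
      (∃ l, (0 < x l ∧ x l < 1) ∧ ¬ (0 < y l ∧ y l < 1)) →
      y ∈ convexHull ℝ (binaryVectors n m) := by
    intro y hy0 hy1 hys hsub ⟨l, hl, hl'⟩
    refine ih _ ?_ y hy0 hy1 hys rfl
    rw [← hk]
    refine Finset.card_lt_card ((Finset.ssubset_iff_of_subset ?_).2 ⟨l, ?_, ?_⟩)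
    · intro l hl
      simpa using hsub l (by simpa using hl)
    · simpa using hl
    · simpa using hl'
  by_cases hfrac : ∃ i, 0 < x i ∧ x i < 1
  · obtain ⟨i, hi0, hi1⟩ := hfrac
    by_cases hfrac' : ∃ j, j ≠ i ∧ 0 < x j ∧ x j < 1
    · obtain ⟨j, hji, hj0, hj1⟩ := hfrac'
      set d : Fin n → ℝ := Pi.single i 1 - Pi.single j 1 with hd
      have hdi : d i = 1 := by simp [hd, hji.symm]
      have hdj : d j = -1 := by simp [hd, hji]
      have hdl : ∀ l, l ≠ i → l ≠ j → d l = 0 := fun l h h' => by simp [hd, h, h']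
      have hds : ∑ l, d l = 0 := by simp [hd, Finset.sum_sub_distrib]
      have move : ∀ r : ℝ, 0 ≤ x i + r → x i + r ≤ 1 → 0 ≤ x j - r → x j - r ≤ 1 →
          (x i + r = 0 ∨ x i + r = 1 ∨ x j - r = 0 ∨ x j - r = 1) →
          x + r • d ∈ convexHull ℝ (binaryVectors n m) := by
        intro r a1 a2 a3 a4 a5
        have ei : (x + r • d) i = x i + r := by simp [hdi]
        have ej : (x + r • d) j = x j - r := by simp [hdj, sub_eq_add_neg]
        have el : ∀ l, l ≠ i → l ≠ j → (x + r • d) l = x l := fun l h h' => by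
          simp [hdl l h h']
        have cases : ∀ l, l = i ∨ l = j ∨ (l ≠ i ∧ l ≠ j) := fun l => by tauto
        refine step _ ?_ ?_ ?_ ?_ ?_
        · intro l
          rcases cases l with rfl | rfl | ⟨h, h'⟩
          · rwa [ei]
          · rwa [ej]
          · rw [el l h h']; exact h0 l
        · intro l
          rcases cases l with rfl | rfl | ⟨h, h'⟩
          · rwa [ei]
          · rwa [ej]
          · rw [el l h h']; exact h1 l
        · simpa [Finset.sum_add_distrib, ← Finset.mul_sum, hds] using hsum
        · intro l hl
          rcases cases l with rfl | rfl | ⟨h, h'⟩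
          · exact ⟨hi0, hi1⟩
          · exact ⟨hj0, hj1⟩
          · rwa [el l h h'] at hl
        · by_cases hir : x i + r = 0 ∨ x i + r = 1
          · refine ⟨i, ⟨hi0, hi1⟩, ?_⟩
            rw [ei]
            rintro ⟨b1, b2⟩
            rcases hir with h | h <;> linarith
          · refine ⟨j, ⟨hj0, hj1⟩, ?_⟩
            rw [ej]
            rintro ⟨b1, b2⟩
            rcases a5 with h | h | h | h
            · exact hir (Or.inl h)
            · exact hir (Or.inr h)
            · linarith
            · linarith
      refine (convex_convexHull ℝ _).mem_of_add_smul_mem_of_sub_smul_mem (d := d)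
        (s := min (1 - x i) (x j)) (t := min (x i) (1 - x j))
        (lt_min (by linarith) hj0) (lt_min hi0 (by linarith)) ?_ ?_
      · rcases min_cases (1 - x i) (x j) with ⟨h, h'⟩ | ⟨h, h'⟩ <;> rw [h]
        · exact move _ (by linarith) (by linarith) (by linarith) (by linarith)
            (Or.inr (Or.inl (by ring)))
        · exact move _ (by linarith) (by linarith) (by linarith) (by linarith)
            (Or.inr (Or.inr (Or.inl (by ring))))
      · rw [sub_eq_add_neg, ← neg_smul]
        rcases min_cases (x i) (1 - x j) with ⟨h, h'⟩ | ⟨h, h'⟩ <;> rw [h]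
        · exact move _ (by linarith) (by linarith) (by linarith) (by linarith)
            (Or.inl (by ring))
        · exact move _ (by linarith) (by linarith) (by linarith) (by linarith)
            (Or.inr (Or.inr (Or.inr (by ring))))
    · have hother : ∀ j, j ≠ i → x j = 0 ∨ x j = 1 := by
        intro j hj
        by_contra! hne
        exact hfrac' ⟨j, hj, (h0 j).lt_of_ne' hne.1, (h1 j).lt_of_ne hne.2⟩
      have hsplit : ∀ r : ℝ, ∑ l, (x + r • (Pi.single i 1 : Fin n → ℝ)) l
          = x i + r + ∑ l ∈ Finset.univ.erase i, x l := by
        intro r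
        rw [← Finset.add_sum_erase _ _ (Finset.mem_univ i)]
        congr 1
        · simp
        · refine Finset.sum_congr rfl fun l hl => ?_
          simp [Finset.ne_of_mem_erase hl]
      obtain ⟨N, hN⟩ := exists_natCast_eq_sum_of_binary (Finset.univ.erase i) x
        fun l hl => hother l (Finset.ne_of_mem_erase hl)
      have hNm : (N : ℝ) + 1 ≤ m := by
        have h := hsplit 0
        simp only [zero_smul, add_zero, hN] at h
        have : (N : ℝ) < m := by linarith
        exact_mod_cast this
      have round : ∀ r : ℝ, x i + r = 0 ∨ x i + r = 1 →
          x + r • (Pi.single i 1 : Fin n → ℝ) ∈ convexHull ℝ (binaryVectors n m) := by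
        intro r hr
        refine subset_convexHull ℝ _ ⟨fun l => ?_, ?_⟩
        · by_cases hl : l = i
          · subst hl
            simpa using hr
          · simpa [hl] using hother l hl
        · rw [hsplit, hN]
          rcases hr with h | h <;> linarith
      refine (convex_convexHull ℝ _).mem_of_add_smul_mem_of_sub_smul_mem
        (d := Pi.single i 1) (s := 1 - x i) (t := x i) (by linarith) hi0
        (round _ (Or.inr (by ring))) ?_
      rw [sub_eq_add_neg, ← neg_smul]
      exact round _ (Or.inl (by ring))
  · refine subset_convexHull ℝ _ ⟨fun i => ?_, hsum⟩
    by_contra! hne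
    exact hfrac ⟨i, (h0 i).lt_of_ne' hne.1, (h1 i).lt_of_ne hne.2⟩

/-- The jobs selected by a 0/1 vector with at most `m` ones can be assigned to distinct
processors. -/
lemma exists_assignment_of_mem_binaryVectors {m n : ℕ} (hm : 1 ≤ m) {v : Fin n → ℝ}
    (hv : v ∈ binaryVectors n m) :
    ∃ B : Fin n → Fin m → ℝ, (∀ i k, B i k = 0 ∨ B i k = 1) ∧
      (∀ i, ∑ k, B i k = v i) ∧ ∀ k, ∑ i, B i k ≤ 1 := by
  classical
  obtain ⟨hbin, hsum⟩ := hv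
  have : Nonempty (Fin m) := ⟨⟨0, hm⟩⟩
  have hv' : ∀ i, v i = if v i = 1 then 1 else 0 := fun i => by
    rcases hbin i with h | h <;> simp [h]
  set S := Finset.univ.filter fun i => v i = 1 with hS
  have hcard : S.card ≤ m := by
    rw [Finset.sum_congr rfl fun i _ => hv' i, Finset.sum_boole] at hsum
    exact_mod_cast hsum
  obtain ⟨f, -, hf⟩ := S.finite_toSet.exists_injOn_of_encard_le
    (t := (Set.univ : Set (Fin m))) (by simpa using hcard)
  refine ⟨fun i k => if f i = k then v i else 0, fun i k => ?_, fun i => by simp, fun k => ?_⟩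
  · dsimp only
    split_ifs
    · exact hbin i
    · exact Or.inl rfl
  · have hB : ∀ i, (if f i = k then v i else 0) = if v i = 1 ∧ f i = k then (1 : ℝ) else 0 := by
      intro i
      rcases hbin i with h | h <;> simp [h]
    rw [Finset.sum_congr rfl fun i _ => hB i, Finset.sum_boole]
    norm_cast
    refine Finset.card_le_one.2 fun i hi j hj => ?_
    simp only [Finset.mem_filter, Finset.mem_univ, true_and] at hi hj
    exact hf (by simp [hS, hi.1]) (by simp [hS, hj.1]) (hi.2.trans hj.2.symm)


/-- Discrete-time realization with binary assignments: the required execution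
fractions `a` can be realized over a window of normalized length 1 partitioned
into `M ≥ n + 1` variable-length slots with a constant binary job-to-processor
assignment on each slot. -/
theorem discrete_binary_realization
    (m n M : ℕ) (hm : 1 ≤ m) (hM : n + 1 ≤ M)
    (a : Fin n → ℝ) (ha0 : ∀ i, 0 ≤ a i) (ha1 : ∀ i, a i ≤ 1)
    (hsum : ∑ i, a i ≤ (m : ℝ)) :
    ∃ hstep : Fin M → ℝ, ∃ b : Fin n → Fin m → Fin M → ℝ,
      (∀ ν, 0 ≤ hstep ν) ∧
      (∑ ν, hstep ν = 1) ∧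
      (∀ i k ν, b i k ν = 0 ∨ b i k ν = 1) ∧
      (∀ i ν, ∑ k, b i k ν ≤ 1) ∧
      (∀ k ν, ∑ i, b i k ν ≤ 1) ∧
      (∀ i, ∑ ν, ∑ k, hstep ν * b i k ν = a i) := by
  classical
  obtain ⟨ι, _, z, w, hz, hind, hw0, hw1, hwz⟩ := eq_pos_convex_span_of_mem_convexHull
    (mem_convexHull_binaryVectors a ha0 ha1 hsum)
  have hcard : Fintype.card ι ≤ Fintype.card (Fin M) := by
    have h₁ := hind.card_le_finrank_succ
    have h₂ := Submodule.finrank_le (vectorSpan ℝ (Set.range z))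
    simp only [Module.finrank_fin_fun] at h₂
    simp only [Fintype.card_fin]
    omega
  obtain ⟨e⟩ := Function.Embedding.nonempty_of_card_le hcard
  have hg : ∀ ν, Function.extend e z 0 ν ∈ binaryVectors n m := by
    intro ν
    by_cases h : ∃ c, e c = ν
    · obtain ⟨c, rfl⟩ := h
      rw [e.injective.extend_apply]
      exact hz ⟨c, rfl⟩
    · rw [Function.extend_apply' _ _ _ h]
      exact ⟨fun i => Or.inl rfl, by simp⟩
  choose B hB01 hBjob hBproc using fun ν => exists_assignment_of_mem_binaryVectors hm (hg ν)
  refine ⟨fun ν => ∑ c, if e c = ν then w c else 0, fun i k ν => B ν i k, fun ν => ?_, ?_,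
    fun i k ν => hB01 ν i k, fun i ν => ?_, fun k ν => hBproc ν k, fun i => ?_⟩
  · refine Finset.sum_nonneg fun c _ => ?_
    split_ifs
    · exact (hw0 c).le
    · exact le_rfl
  · rw [Finset.sum_comm]
    simpa using hw1
  · rw [hBjob]
    rcases (hg ν).1 i with h | h <;> simp [h]
  · simp_rw [← Finset.mul_sum, hBjob, Finset.sum_mul]
    rw [Finset.sum_comm]
    simp only [ite_mul, zero_mul, Finset.sum_ite_eq, Finset.mem_univ, if_true,
      e.injective.extend_apply]
    simpa using congrFun hwz i
end

section
/- Schedule construction for the NLP formulation (Theorem 2): let m ≥ 1, let 0 = τ₀ < τ₁ < ⋯ < τ_N be the deadline-partition grid points, and for each job i ∈ Fin n let arrival and deadline indices α i < δ i ≤ N be given. Suppose a : Fin n → Fin N → ℝ satisfies 0 ≤ a i μ ≤ 1 for all i, μ, a i μ = 0 unless α i ≤ μ < δ i, and ∑ i, a i μ ≤ m for every μ. Then there exist Lebesgue-measurable sets σ : Fin n → Fin m → Set ℝ with σ i k ⊆ [τ_{α i}, τ_{δ i}) such that: for every time t and every processor k there is at most one job i with t ∈ σ i k; for every time t and every job i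 there is at most one processor k with t ∈ σ i k; and for every job i and every grid interval μ, ∑ k, volume (σ i k ∩ [τ_μ, τ_{μ+1})) = a i μ · (τ_{μ+1} − τ_μ). In particular, every solution of the finite-dimensional NLP yields a valid continuous-time multiprocessor schedule respecting all arrival times, deadlines and processor constraints, in which each job executes for exactly the prescribed fraction of each grid interval (hence with the same energy consumption as the NLP objective). -/
open MeasureTheory

/-- McNaughton's wrap-around rule on the time slot `[c, c + L)`: the times at which processor `k`
executes the part `[p, q)` of the processors' joint capacity, where processor `k` provides
the unit of capacity `[k, k + 1)`. -/
def wrapAround (c L p q : ℝ) (k : ℕ) : Set ℝ :=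
  Set.Ico c (c + L) ∩ Set.Ico (c + L * (p - k)) (c + L * (q - k))

theorem measurableSet_wrapAround (c L p q : ℝ) (k : ℕ) : MeasurableSet (wrapAround c L p q k) :=
  measurableSet_Ico.inter measurableSet_Ico

theorem volume_wrapAround {c L p q : ℝ} (hL : 0 ≤ L) (hpq : p ≤ q) (k : ℕ) :
    (volume (wrapAround c L p q k)).toReal =
      L * (max 0 (min 1 (q - k)) - max 0 (min 1 (p - k))) := by
  have hq : L * min 1 (q - k) = min L (L * (q - k)) := by
    rw [mul_min_of_nonneg _ _ hL, mul_one]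
  have hp : L * min 1 (p - k) = min L (L * (p - k)) := by
    rw [mul_min_of_nonneg _ _ hL, mul_one]
  have hle : L * (p - k) ≤ L * (q - k) := by gcongr
  rw [wrapAround, Set.Ico_inter_Ico, Real.volume_Ico, ENNReal.toReal_ofReal',
    mul_sub L (max _ _), mul_max_of_nonneg _ _ hL, mul_max_of_nonneg _ _ hL, hq, hp, mul_zero]
  grind

theorem sum_clamp_sub_natCast (m : ℕ) (x : ℝ) :
    ∑ k ∈ Finset.range m, max 0 (min 1 (x - k)) = max 0 (min (m : ℝ) x) := by
  induction m with
  | zero => simp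
  | succ m ih =>
    have hm : (0 : ℝ) ≤ m := m.cast_nonneg
    rw [Finset.sum_range_succ, ih]
    push_cast
    grind

theorem sum_volume_wrapAround {c L p q : ℝ} (m : ℕ) (hL : 0 ≤ L) (hp : 0 ≤ p) (hpq : p ≤ q)
    (hq : q ≤ m) :
    ∑ k : Fin m, (volume (wrapAround c L p q k)).toReal = L * (q - p) := by
  simp only [volume_wrapAround hL hpq]
  rw [← Finset.mul_sum, Finset.sum_sub_distrib,
    Fin.sum_univ_eq_sum_range (fun k : ℕ => max 0 (min 1 (q - (k : ℝ)))),
    Fin.sum_univ_eq_sum_range (fun k : ℕ => max 0 (min 1 (p - (k : ℝ)))),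
    sum_clamp_sub_natCast, sum_clamp_sub_natCast, min_eq_right hq, min_eq_right (hpq.trans hq),
    max_eq_right hp, max_eq_right (hp.trans hpq)]

theorem lt_of_mem_wrapAround {c L p q p' q' t : ℝ} {k k' : ℕ} (hL : 0 < L)
    (h : t ∈ wrapAround c L p q k) (h' : t ∈ wrapAround c L p' q' k') : p - k < q' - k' := by
  have := h.2.1.trans_lt h'.2.2
  exact lt_of_mul_lt_mul_left (by linarith) hL.le

/-- The capacity used in slot `μ` by the jobs preceding job `i`. -/
def precedingLoad {n N : ℕ} (a : Fin n → Fin N → ℝ) (i : Fin n) (μ : Fin N) : ℝ :=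
  ∑ j ∈ Finset.Iio i, a j μ

section precedingLoad

variable {n N : ℕ} {a : Fin n → Fin N → ℝ}

theorem precedingLoad_add (i : Fin n) (μ : Fin N) :
    precedingLoad a i μ + a i μ = ∑ j ∈ Finset.Iic i, a j μ := by
  rw [precedingLoad, ← Finset.Iio_insert, Finset.sum_insert (by simp), add_comm]

theorem precedingLoad_add_le_of_lt (ha0 : ∀ i μ, 0 ≤ a i μ) {i j : Fin n} (hij : i < j)
    (μ : Fin N) : precedingLoad a i μ + a i μ ≤ precedingLoad a j μ := by
  rw [precedingLoad_add]
  refine Finset.sum_le_sum_of_subset_of_nonneg (fun x hx => ?_) fun x _ _ => ha0 x μ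
  exact Finset.mem_Iio.2 ((Finset.mem_Iic.1 hx).trans_lt hij)

theorem precedingLoad_add_le_sum (ha0 : ∀ i μ, 0 ≤ a i μ) (i : Fin n) (μ : Fin N) :
    precedingLoad a i μ + a i μ ≤ ∑ j, a j μ := by
  rw [precedingLoad_add]
  exact Finset.sum_le_sum_of_subset_of_nonneg (Finset.subset_univ _) fun x _ _ => ha0 x μ

end precedingLoad

/-- Schedule construction for the NLP formulation: fractions `a i μ` of each
deadline-partition grid interval `[τ_μ, τ_{μ+1})`, vanishing outside job `i`'s
arrival-to-deadline window and with total density at most `m` on each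
interval, can be realized by a valid continuous-time multiprocessor schedule
respecting all arrival times, deadlines and processor constraints. -/
theorem nlp_schedule_exists
    (m n N : ℕ) (hm : 1 ≤ m)
    (τgrid : ℕ → ℝ) (hτ0 : τgrid 0 = 0)
    (hτmono : ∀ μ < N, τgrid μ < τgrid (μ + 1))
    (α δ : Fin n → ℕ)
    (hαδ : ∀ i, α i < δ i) (hδN : ∀ i, δ i ≤ N)
    (a : Fin n → Fin N → ℝ)
    (ha0 : ∀ i μ, 0 ≤ a i μ) (ha1 : ∀ i μ, a i μ ≤ 1)
    (hwin : ∀ i, ∀ μ : Fin N, ¬(α i ≤ (μ : ℕ) ∧ (μ : ℕ) < δ i) → a i μ = 0)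
    (hcap : ∀ μ : Fin N, ∑ i, a i μ ≤ (m : ℝ)) :
    ∃ σ : Fin n → Fin m → Set ℝ,
      (∀ i k, MeasurableSet (σ i k)) ∧
      (∀ i k, σ i k ⊆ Set.Ico (τgrid (α i)) (τgrid (δ i))) ∧
      (∀ t : ℝ, ∀ k : Fin m, ∀ i₁ i₂ : Fin n,
        t ∈ σ i₁ k → t ∈ σ i₂ k → i₁ = i₂) ∧
      (∀ t : ℝ, ∀ i : Fin n, ∀ k₁ k₂ : Fin m,
        t ∈ σ i k₁ → t ∈ σ i k₂ → k₁ = k₂) ∧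
      (∀ i : Fin n, ∀ μ : Fin N,
        ∑ k : Fin m,
          (volume (σ i k ∩ Set.Ico (τgrid (μ : ℕ)) (τgrid ((μ : ℕ) + 1)))).toReal
        = a i μ * (τgrid ((μ : ℕ) + 1) - τgrid (μ : ℕ))) := by
  have hmono : ∀ i j, i ≤ j → j ≤ N → τgrid i ≤ τgrid j := by
    intro i j hij
    induction j, hij using Nat.le_induction with
    | base => exact fun _ => le_rfl
    | succ j _ ih => exact fun hj => (ih (by lia)).trans (hτmono j (by lia)).le
  have hslot : ∀ (t : ℝ) (μ ν : Fin N), t ∈ Set.Ico (τgrid μ) (τgrid (μ + 1)) →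
      t ∈ Set.Ico (τgrid ν) (τgrid (ν + 1)) → μ = ν := by
    intro t μ ν hμ hν
    by_contra hne
    rcases lt_or_gt_of_ne hne with h | h
    · exact absurd (hmono (μ + 1) ν h ν.2.le) (not_le.2 (hν.1.trans_lt hμ.2))
    · exact absurd (hmono (ν + 1) μ h μ.2.le) (not_le.2 (hμ.1.trans_lt hν.2))
  let L : Fin N → ℝ := fun μ => τgrid (μ + 1) - τgrid μ
  have hL : ∀ μ, 0 < L μ := fun μ => sub_pos.2 (hτmono μ μ.2)
  let W : Fin n → Fin m → Fin N → Set ℝ := fun i k μ =>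
    wrapAround (τgrid μ) (L μ) (precedingLoad a i μ) (precedingLoad a i μ + a i μ) k
  have hW : ∀ i k μ, W i k μ ⊆ Set.Ico (τgrid μ) (τgrid (μ + 1)) := by
    intro i k μ t ht
    simpa [L] using ht.1
  refine ⟨fun i k => ⋃ μ, W i k μ, fun i k => MeasurableSet.iUnion fun μ =>
    measurableSet_wrapAround _ _ _ _ _, ?_, ?_, ?_, ?_⟩
  · intro i k
    refine Set.iUnion_subset fun μ t ht => ?_
    have hwindow : α i ≤ (μ : ℕ) ∧ (μ : ℕ) < δ i := by
      by_contra hout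
      have := lt_of_mem_wrapAround (hL μ) ht ht
      linarith [hwin i μ hout]
    have htμ := hW i k μ ht
    exact ⟨(hmono _ _ hwindow.1 μ.2.le).trans htμ.1,
      htμ.2.trans_le (hmono _ _ hwindow.2 (hδN i))⟩
  · intro t k i₁ i₂ h₁ h₂
    obtain ⟨μ, h₁⟩ := Set.mem_iUnion.1 h₁
    obtain ⟨ν, h₂⟩ := Set.mem_iUnion.1 h₂
    obtain rfl := hslot t μ ν (hW _ _ _ h₁) (hW _ _ _ h₂)
    by_contra hne
    rcases lt_or_gt_of_ne hne with h | h
    · linarith [precedingLoad_add_le_of_lt ha0 h μ, lt_of_mem_wrapAround (hL μ) h₂ h₁]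
    · linarith [precedingLoad_add_le_of_lt ha0 h μ, lt_of_mem_wrapAround (hL μ) h₁ h₂]
  · intro t i k₁ k₂ h₁ h₂
    obtain ⟨μ, h₁⟩ := Set.mem_iUnion.1 h₁
    obtain ⟨ν, h₂⟩ := Set.mem_iUnion.1 h₂
    obtain rfl := hslot t μ ν (hW _ _ _ h₁) (hW _ _ _ h₂)
    have h₁₂ : ((k₁ : ℕ) : ℝ) < (k₂ : ℕ) + 1 := by
      linarith [ha1 i μ, lt_of_mem_wrapAround (hL μ) h₂ h₁]
    have h₂₁ : ((k₂ : ℕ) : ℝ) < (k₁ : ℕ) + 1 := by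
      linarith [ha1 i μ, lt_of_mem_wrapAround (hL μ) h₁ h₂]
    norm_cast at h₁₂ h₂₁
    exact Fin.ext (by lia)
  · intro i μ
    have hinter : ∀ k, (⋃ ν, W i k ν) ∩ Set.Ico (τgrid μ) (τgrid (μ + 1)) = W i k μ := by
      intro k
      ext t
      refine ⟨fun ⟨h, ht⟩ => ?_, fun h => ⟨Set.mem_iUnion.2 ⟨μ, h⟩, hW i k μ h⟩⟩
      obtain ⟨ν, h⟩ := Set.mem_iUnion.1 h
      obtain rfl := hslot t ν μ (hW _ _ _ h) ht
      exact h
    simp only [hinter]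
    have hload : 0 ≤ precedingLoad a i μ := Finset.sum_nonneg fun j _ => ha0 j μ
    refine (sum_volume_wrapAround m (hL μ).le hload (le_add_of_nonneg_right (ha0 i μ))
      ((precedingLoad_add_le_sum ha0 i μ).trans (hcap μ))).trans ?_
    simp only [L]
    ring
end
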